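/- For every t > 2, the left-greedy algorithm on t stacks in series does not sort a closed (pattern-avoidance) class of permutations: the permutation 2,6,3,5,1,7,8,...,(t+5),4 is sortable by the left-greedy algorithm on t stacks in series and contains the pattern 2,5,4,1,6,7,...,(t+4),3, yet the latter permutation is not sortable by the left-greedy algorithm on t stacks in series. -/

import Mathlib

/-- A configuration for sorting with `t` stacks in series: the remaining input,
the stacks (index `0` is the leftmost, next to the output; index `t-1` is the
rightmost, next to the input; the head of each list is the top of the stack),
and the output produced so far. -/
structure Conf where
  input : List ℕ
  stks : List (List ℕ)
  output : List ℕ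
deriving DecidableEq, Repr

/-- `x` may be placed on top of a stack iff the stack is empty or `x` is smaller
than the current top (stacks are increasing from top to bottom). -/
def canPush (x : ℕ) : List ℕ → Bool
  | [] => true
  | y :: _ => decide (x < y)

/-- Moves, ordered left to right: `0` = pop the leftmost stack to the output
(legal only for the next element of the identity); `m` with `0 < m < t` = move the
top of stack `m` one stack to the left; `t` = push the next input element onto the
rightmost stack. -/
def legal (t : ℕ) (c : Conf) (m : ℕ) : Bool :=
  if m = 0 then
    match c.stks.getD 0 [] with
    | x :: _ => x == c.output.length + 1
    | [] => false
  else if m < t then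
    match c.stks.getD m [] with
    | x :: _ => canPush x (c.stks.getD (m-1) [])
    | [] => false
  else if m = t then
    match c.input with
    | x :: _ => canPush x (c.stks.getD (t-1) [])
    | [] => false
  else false

/-- Perform move `m` on configuration `c` (with `t` stacks). -/
def applyMove (t : ℕ) (c : Conf) (m : ℕ) : Conf :=
  if m = 0 then
    match c.stks.getD 0 [] with
    | x :: s => ⟨c.input, c.stks.set 0 s, c.output ++ [x]⟩
    | [] => c
  else if m < t then
    match c.stks.getD m [] with
    | x :: s => ⟨c.input, (c.stks.set m s).set (m-1) (x :: c.stks.getD (m-1) []), c.output⟩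
    | [] => c
  else
    match c.input with
    | x :: rest => ⟨rest, c.stks.set (t-1) (x :: c.stks.getD (t-1) []), c.output⟩
    | [] => c

def initConf (t : ℕ) (p : List ℕ) : Conf := ⟨p, List.replicate t [], []⟩

/-- The fully sorted configuration: empty input and stacks, output `1,2,...,n`. -/
def finalConf (t n : ℕ) : Conf := ⟨[], List.replicate t [], List.range' 1 n⟩

/-- Run a sequence of moves, requiring each to be legal. -/
def runLegal (t : ℕ) : Conf → List ℕ → Option Conf
  | c, [] => some c
  | c, m :: ms => if legal t c m then runLegal t (applyMove t c m) ms else none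

/-- `p` is sortable by `t` stacks in series by some sequence of legal moves. -/
def Sortable (t : ℕ) (p : List ℕ) : Prop :=
  ∃ ms : List ℕ, runLegal t (initConf t p) ms = some (finalConf t p.length)

/-- The leftmost legal move, if any. -/
def leftMove (t : ℕ) (c : Conf) : Option ℕ :=
  ((List.range (t+1)).filter (fun m => legal t c m)).head?

/-- The rightmost legal move, if any. -/
def rightMove (t : ℕ) (c : Conf) : Option ℕ :=
  ((List.range (t+1)).filter (fun m => legal t c m)).getLast?

/-- One step of a greedy algorithm given by the move selector `mv`
(the configuration is unchanged if no move is legal, i.e. the algorithm fails or is done). -/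
def greedyStep (mv : ℕ → Conf → Option ℕ) (t : ℕ) (c : Conf) : Conf :=
  match mv t c with
  | some m => applyMove t c m
  | none => c

/-- The greedy algorithm given by `mv` sorts `p` with `t` stacks in series. -/
def GreedySorts (mv : ℕ → Conf → Option ℕ) (t : ℕ) (p : List ℕ) : Prop :=
  ∃ k : ℕ, (greedyStep mv t)^[k] (initConf t p) = finalConf t p.length

def LeftGreedySorts : ℕ → List ℕ → Prop := GreedySorts leftMove
def RightGreedySorts : ℕ → List ℕ → Prop := GreedySorts rightMove

/-- `p` is a permutation of `1,...,n` (as a list). -/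
def IsPermOf (n : ℕ) (p : List ℕ) : Prop := p.Perm (List.range' 1 n)

/-- The position of the element `x` in configuration `c`: `0` if in the output
(furthest left), `j+1` if in stack `j`, `t+1` if still in the input (furthest right). -/
def posOf (t : ℕ) (c : Conf) (x : ℕ) : ℕ :=
  if x ∈ c.output then 0
  else match (List.range t).find? (fun j => decide (x ∈ c.stks.getD j [])) with
    | some j => j + 1
    | none => t + 1

/-- `c` is at the `i`-th critical moment for the greedy algorithm `mv` on a
permutation of length `n`: either the chosen move is the entry of the `i`-th
element into the stacks, or the algorithm fails (no legal move, incomplete output). -/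
def IsCrit (mv : ℕ → Conf → Option ℕ) (t i n : ℕ) (c : Conf) : Prop :=
  (c.input.length + i = n + 1 ∧ mv t c = some t) ∨
  (mv t c = none ∧ c.output.length < n)

/-- `c` is the configuration at the `i`-th critical moment of the greedy algorithm
`mv` run on `p` (the first moment along the run satisfying `IsCrit`). -/
def CritConf (mv : ℕ → Conf → Option ℕ) (t i n : ℕ) (p : List ℕ) (c : Conf) : Prop :=
  ∃ k : ℕ, (greedyStep mv t)^[k] (initConf t p) = c ∧ IsCrit mv t i n c ∧
    ∀ k' < k, ¬ IsCrit mv t i n ((greedyStep mv t)^[k'] (initConf t p))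

/-- No stack is empty while some stack to its right is nonempty. -/
def NoGap (t : ℕ) (c : Conf) : Prop :=
  ∀ j j' : ℕ, j < j' → j' < t → c.stks.getD j' [] ≠ [] → c.stks.getD j [] ≠ []

/-- `r` contains `q` as a pattern. -/
def ContainsPat (r q : List ℕ) : Prop :=
  ∃ f : Fin q.length → Fin r.length, StrictMono f ∧
    ∀ a b : Fin q.length, q.get a < q.get b ↔ r.get (f a) < r.get (f b)

/-- The configuration whose stack `i` is `f i` for `i < t`. -/
def confOf (t : ℕ) (inp : List ℕ) (f : ℕ → List ℕ) (out : List ℕ) : Conf :=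
  ⟨inp, (List.range t).map f, out⟩

/-- Whether move `m < t` is legal, given the stacks and the length `n` of the output. -/
def shiftable (f : ℕ → List ℕ) (n : ℕ) : ℕ → Bool
  | 0 => match f 0 with
    | x :: _ => x == n + 1
    | [] => false
  | m + 1 => match f (m + 1) with
    | x :: _ => canPush x (f m)
    | [] => false

/-- The left-greedy algorithm leads from `c` to `d`. -/
def Reaches (t : ℕ) (c d : Conf) : Prop := ∃ k : ℕ, (greedyStep leftMove t)^[k] c = d

theorem Reaches.refl (t : ℕ) (c : Conf) : Reaches t c c := ⟨0, rfl⟩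

theorem Reaches.trans {t : ℕ} {c d e : Conf} (h : Reaches t c d) (h' : Reaches t d e) :
    Reaches t c e := by
  obtain ⟨k, rfl⟩ := h
  obtain ⟨l, rfl⟩ := h'
  exact ⟨l + k, Function.iterate_add_apply _ _ _ _⟩

theorem Reaches.eq_of_fixed {t : ℕ} {c d e : Conf} (hd : Reaches t c d) (he : Reaches t c e)
    (fd : greedyStep leftMove t d = d) (fe : greedyStep leftMove t e = e) : d = e := by
  obtain ⟨k, hk⟩ := hd
  obtain ⟨l, hl⟩ := he
  rw [← Function.iterate_fixed fd l, ← hk, ← Function.iterate_add_apply, Nat.add_comm,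
    Function.iterate_add_apply, hl, Function.iterate_fixed fe k]

theorem getD_map_range {t j : ℕ} (hj : j < t) (f : ℕ → List ℕ) :
    ((List.range t).map f).getD j [] = f j := by
  simp [List.getD, hj]

theorem set_map_range {t j : ℕ} (f : ℕ → List ℕ) (s : List ℕ) :
    ((List.range t).map f).set j s = (List.range t).map (Function.update f j s) := by
  apply List.ext_getElem
  · simp
  · intro i h₁ h₂
    simp [List.getElem_set, Function.update_apply, eq_comm]

theorem legal_confOf {t m : ℕ} (hm : m < t) (inp : List ℕ) (f : ℕ → List ℕ) (out : List ℕ) :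
    legal t (confOf t inp f out) m = shiftable f out.length m := by
  cases m with
  | zero => simp only [legal, confOf, getD_map_range hm, shiftable]; rfl
  | succ m =>
    simp only [legal, confOf, getD_map_range hm, getD_map_range (Nat.lt_of_succ_lt hm), shiftable,
      Nat.add_sub_cancel, if_pos hm, if_neg (Nat.succ_ne_zero m)]

theorem greedyStep_of_legal {t m : ℕ} {c : Conf} (hm : m ≤ t) (h : legal t c m = true)
    (h' : ∀ i < m, legal t c i = false) : greedyStep leftMove t c = applyMove t c m := by
  have : leftMove t c = some m := by
    rw [leftMove, List.head?_filter, List.find?_range_eq_some]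
    exact ⟨h, by simpa using Nat.lt_succ_of_le hm, fun i hi => by simp [h' i hi]⟩
  simp [greedyStep, this]

theorem greedyStep_of_not_legal {t : ℕ} {c : Conf} (h : ∀ i ≤ t, legal t c i = false) :
    greedyStep leftMove t c = c := by
  have : leftMove t c = none := by
    rw [leftMove, List.head?_filter, List.find?_eq_none]
    intro i hi
    simp [h i (Nat.le_of_lt_succ (List.mem_range.1 hi))]
  simp [greedyStep, this]

theorem shiftable_congr {f g : ℕ → List ℕ} {n m : ℕ} (h : ∀ i ≤ m, f i = g i) :
    shiftable f n m = shiftable g n m := by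
  cases m with
  | zero => simp [shiftable, h]
  | succ m => simp [shiftable, h]

theorem reaches_pop {t x : ℕ} {inp s out : List ℕ} {f g : ℕ → List ℕ} (ht : 0 < t)
    (hf : f 0 = x :: s) (hx : x = out.length + 1) (hg : g = Function.update f 0 s) :
    Reaches t (confOf t inp f out) (confOf t inp g (out ++ [x])) := by
  refine ⟨1, ?_⟩
  rw [Function.iterate_one, greedyStep_of_legal (m := 0) (Nat.zero_le _)]
  · simp only [applyMove, confOf, getD_map_range ht, hf, set_map_range, hg]
    rfl
  · rw [legal_confOf ht]
    simp [shiftable, hf, hx]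
  · simp

/-- An element on top of stack `j` slides left to stack `k`. -/
theorem reaches_slide {t x k j : ℕ} {inp out : List ℕ} {f g h : ℕ → List ℕ}
    (hk : k ≤ j) (hj : j < t) (hg : g = Function.update f j (x :: f j))
    (hh : h = Function.update f k (x :: f k)) (hq : ∀ m < j, shiftable f out.length m = false)
    (hp : ∀ i, k ≤ i → i < j → canPush x (f i) = true) :
    Reaches t (confOf t inp g out) (confOf t inp h out) := by
  subst hg hh
  induction j, hk using Nat.le_induction with
  | base => exact .refl _ _
  | succ j hkj ih =>
    refine Reaches.trans ⟨1, ?_⟩ (ih (by lia) (fun m hm => hq m (by lia))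
      (fun i h₁ h₂ => hp i h₁ (by lia)))
    rw [Function.iterate_one, greedyStep_of_legal (m := j + 1) hj.le]
    · simp only [applyMove, confOf, getD_map_range hj, set_map_range, if_pos hj,
        if_neg (Nat.succ_ne_zero j), Nat.add_sub_cancel, getD_map_range (Nat.lt_of_succ_lt hj)]
      simp
    · rw [legal_confOf hj]
      simpa [shiftable] using hp j hkj (by lia)
    · intro i hi
      rw [legal_confOf (by lia), ← hq i hi]
      apply shiftable_congr
      intro l hl
      rw [Function.update_of_ne (by lia)]

/-- The next input element enters and slides left to stack `k`. -/
theorem reaches_enter {t x : ℕ} (k : ℕ) {inp out : List ℕ} {f h : ℕ → List ℕ} (hk : k < t)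
    (hh : h = Function.update f k (x :: f k)) (hq : ∀ m < t, shiftable f out.length m = false)
    (hp : ∀ i, k ≤ i → i < t → canPush x (f i) = true) :
    Reaches t (confOf t (x :: inp) f out) (confOf t inp h out) := by
  obtain ⟨t, rfl⟩ : ∃ s, t = s + 1 := ⟨t - 1, by lia⟩
  refine Reaches.trans ⟨1, ?_⟩ (reaches_slide (x := x) (j := t) (f := f) (by lia) (by lia) rfl hh
    (fun m hm => hq m (by lia)) (fun i h₁ h₂ => hp i h₁ (by lia)))
  rw [Function.iterate_one, greedyStep_of_legal (m := t + 1) le_rfl]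
  · simp [applyMove, confOf, set_map_range]
  · simpa [legal, confOf] using hp t (by lia) (by lia)
  · intro i hi
    rw [legal_confOf hi, hq i hi]

/-- Stacks `0`, `1`, `2` are given and all others are empty. -/
def threeStacks (a b c : List ℕ) : ℕ → List ℕ
  | 0 => a
  | 1 => b
  | 2 => c
  | _ + 3 => []

theorem threeStacks_update_zero (a b c s : List ℕ) :
    threeStacks s b c = Function.update (threeStacks a b c) 0 s := by
  funext i
  rcases i with _ | _ | _ | i <;> simp [threeStacks]

theorem threeStacks_update_one (a b c s : List ℕ) :
    threeStacks a s c = Function.update (threeStacks a b c) 1 s := by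
  funext i
  rcases i with _ | _ | _ | i <;> simp [threeStacks]

theorem threeStacks_update_two (a b c s : List ℕ) :
    threeStacks a b s = Function.update (threeStacks a b c) 2 s := by
  funext i
  rcases i with _ | _ | _ | i <;> simp [threeStacks]

theorem forall_threeStacks {p : ℕ → Prop} (h₀ : p 0) (h₁ : p 1) (h₂ : p 2) (h : ∀ i, p (i + 3))
    (i : ℕ) : p i :=
  match i with
  | 0 => h₀
  | 1 => h₁
  | 2 => h₂
  | i + 3 => h i

theorem initConf_eq (t : ℕ) (p : List ℕ) :
    initConf t p = confOf t p (threeStacks [] [] []) [] := by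
  have : threeStacks [] [] [] = fun _ => [] :=
    funext (forall_threeStacks rfl rfl rfl fun _ => rfl)
  simp [initConf, confOf, this, List.map_const']

/-- Stack `0` is `s`, stack `i` consists of `i + d` for `a ≤ i < b`,
and all other stacks are empty. -/
def ladder (s : List ℕ) (d a b i : ℕ) : List ℕ :=
  if i = 0 then s else if a ≤ i ∧ i < b then [i + d] else []

theorem ladder_update_zero (s s' : List ℕ) (d a b : ℕ) :
    ladder s' d a b = Function.update (ladder s d a b) 0 s' := by
  funext i
  cases i <;> simp [ladder]

theorem shiftable_ladder {s : List ℕ} {x d b n m : ℕ} (hx : x ≠ n + 1) (hxd : x ≤ d) :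
    shiftable (ladder (x :: s) d 1 b) n m = false := by
  rcases m with _ | _ | m
  · simpa [shiftable, ladder] using hx
  · by_cases hb : 1 < b
    · simp [shiftable, ladder, canPush, hb]; lia
    · simp [shiftable, ladder, hb]
  · by_cases hb : m + 1 + 1 < b
    · simp [shiftable, ladder, canPush, hb, Nat.lt_of_succ_lt hb]
    · simp [shiftable, ladder, hb]

/-- Consecutive inputs fill consecutive stacks. -/
theorem reaches_fill {t x d a : ℕ} {s inp out : List ℕ} (ha : 1 ≤ a) (hx : x ≠ out.length + 1)
    (hxd : x ≤ d) (n : ℕ) (hn : a + n ≤ t) :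
    Reaches t (confOf t (List.range' (a + d) n ++ inp) (ladder (x :: s) d 1 a) out)
      (confOf t inp (ladder (x :: s) d 1 (a + n)) out) := by
  induction n generalizing a with
  | zero => simpa using Reaches.refl _ _
  | succ n ih =>
    have := ih (a := a + 1) (by lia) (by lia)
    rw [show a + 1 + n = a + (n + 1) by lia, show a + 1 + d = a + d + 1 by lia] at this
    rw [List.range'_succ, List.cons_append]
    refine (reaches_enter a (by lia) ?_ (fun m _ => shiftable_ladder hx hxd) ?_).trans this
    · funext i
      simp only [ladder, Function.update_apply]
      split_ifs <;> lia
    · intro i h₁ h₂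
      rw [ladder, if_neg (by lia), if_neg (by lia)]
      rfl

/-- A ladder of consecutive elements drains to the output. -/
theorem reaches_drain {t d a : ℕ} {inp out : List ℕ} (ha : 1 ≤ a) (n : ℕ) (hn : a + n = t)
    (hout : out.length + 1 = a + d) :
    Reaches t (confOf t inp (ladder [] d a t) out)
      (confOf t inp (fun _ => []) (out ++ List.range' (a + d) n)) := by
  induction n generalizing a out with
  | zero =>
    have : ladder [] d a t = fun _ => [] := by
      funext i
      simp only [ladder]
      split_ifs <;> lia
    simpa [this] using Reaches.refl _ _
  | succ n ih =>
    have := ih (a := a + 1) (out := out ++ [a + d]) (by lia) (by lia) (by simp; lia)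
    rw [List.append_assoc, show a + 1 + d = a + d + 1 by lia, List.singleton_append,
      ← List.range'_succ] at this
    refine (reaches_slide (x := a + d) (k := 0) (j := a) (f := ladder [] d (a + 1) t)
      (by lia) (by lia) ?_ rfl ?_ ?_).trans
      ((reaches_pop (by lia) (Function.update_self ..) hout.symm ?_).trans this)
    · funext i
      simp only [ladder, Function.update_apply]
      split_ifs <;> lia
    · rintro (_ | m) hm
      · rfl
      · simp [shiftable, ladder, show ¬ a ≤ m by lia]
    · intro i _ hi
      simp [ladder, canPush, show ¬ a + 1 ≤ i by lia]
    · rw [Function.update_idem]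
      exact (Function.update_eq_self 0 _).symm

theorem confOf_eq_finalConf {t n : ℕ} : confOf t [] (fun _ => []) (List.range' 1 n) =
    finalConf t n := by
  simp [confOf, finalConf, List.map_const']

theorem greedyStep_finalConf {t n : ℕ} (ht : 0 < t) :
    greedyStep leftMove t (finalConf t n) = finalConf t n := by
  rw [← confOf_eq_finalConf]
  apply greedyStep_of_not_legal
  intro i hi
  rcases hi.lt_or_eq with h | rfl
  · rw [legal_confOf h]
    cases i <;> rfl
  · simp [legal, confOf, ht.ne']

theorem containsPat_of_map_sublist {q r : List ℕ} {φ : ℕ → ℕ} (hφ : StrictMono φ)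
    (h : (q.map φ).Sublist r) : ContainsPat r q := by
  obtain ⟨f, hf⟩ := List.sublist_iff_exists_fin_orderEmbedding_get_eq.1 h
  refine ⟨fun i => f (i.cast (by simp)), fun a b hab => f.strictMono (by simpa using hab), ?_⟩
  intro a b
  rw [← hf, ← hf]
  simp [hφ.lt_iff_lt]

theorem leftGreedySorts_long (t : ℕ) (ht : 2 < t) :
    LeftGreedySorts t ([2, 6, 3, 5, 1] ++ List.range' 7 (t - 1) ++ [4]) := by
  change Reaches t _ _
  rw [initConf_eq]
  have h₁ : Reaches t
      (confOf t ([2, 6, 3, 5, 1] ++ List.range' 7 (t - 1) ++ [4]) (threeStacks [] [] []) [])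
      (confOf t (List.range' 7 (t - 1) ++ [4]) (threeStacks [5, 6] [] []) [1, 2, 3]) := by
    refine (reaches_enter 0 (by lia) (threeStacks_update_zero [] [] [] [2])
      (fun m _ => ?_) (fun i h _ => ?_)).trans <|
      (reaches_enter 1 (by lia) (threeStacks_update_one [2] [] [] [6])
      (fun m _ => ?_) (fun i h _ => ?_)).trans <|
      (reaches_enter 1 (by lia) (threeStacks_update_one [2] [6] [] [3, 6])
      (fun m _ => ?_) (fun i h _ => ?_)).trans <|
      (reaches_enter 2 (by lia) (threeStacks_update_two [2] [3, 6] [] [5])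
      (fun m _ => ?_) (fun i h _ => ?_)).trans <|
      (reaches_enter 0 (by lia) (threeStacks_update_zero [2] [3, 6] [5] [1, 2])
      (fun m _ => ?_) (fun i h _ => ?_)).trans <|
      (reaches_pop (by lia) rfl rfl (threeStacks_update_zero _ _ _ _)).trans <|
      (reaches_pop (by lia) rfl rfl (threeStacks_update_zero _ _ _ _)).trans <|
      (reaches_slide (x := 3) (k := 0) (j := 1) (f := threeStacks [] [6] [5]) (by lia) (by lia)
        (threeStacks_update_one ..) (threeStacks_update_zero ..)
        (fun m hm => ?_) (fun i h hi => ?_)).trans <|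
      (reaches_pop (by lia) rfl rfl (threeStacks_update_zero _ _ _ _)).trans <|
      (reaches_slide (x := 6) (k := 0) (j := 1) (f := threeStacks [] [] [5]) (by lia) (by lia)
        (threeStacks_update_one ..) (threeStacks_update_zero ..)
        (fun m hm => ?_) (fun i h hi => ?_)).trans <|
      (reaches_slide (x := 5) (k := 0) (j := 2) (f := threeStacks [6] [] []) (by lia) (by lia)
        (threeStacks_update_two ..) (threeStacks_update_zero ..)
        (fun m hm => ?_) (fun i h hi => ?_))
    all_goals first
      | exact forall_threeStacks (p := fun m => shiftable _ _ m = false) rfl rfl rfl (fun _ => rfl) m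
      | (obtain rfl : m = 0 := by lia); rfl
      | rcases i with _ | _ | _ | i <;> first | rfl | lia
  have h₂ : threeStacks [5, 6] [] [] = ladder [5, 6] 6 1 1 := by
    funext i
    rcases i with _ | _ | _ | i <;> simp [threeStacks, ladder]
  rw [h₂] at h₁
  refine h₁.trans ((reaches_fill (x := 5) (d := 6) (a := 1) (s := [6])
    (out := [1, 2, 3]) le_rfl (by simp) (by lia) (t - 1) (by lia)).trans ?_)
  rw [show 1 + (t - 1) = t by lia]
  refine (reaches_enter 0 (by lia) (ladder_update_zero [5, 6] [4, 5, 6] ..)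
    (fun m _ => shiftable_ladder (x := 5) (by simp) (by lia))
    (fun i _ hi => ?_)).trans <|
    (reaches_pop (by lia) rfl rfl (ladder_update_zero _ _ _ _ _)).trans <|
    (reaches_pop (by lia) rfl rfl (ladder_update_zero _ _ _ _ _)).trans <|
    (reaches_pop (by lia) rfl rfl (ladder_update_zero _ _ _ _ _)).trans ?_
  · rcases i with _ | i
    · rfl
    · simp [ladder, canPush, hi]
  have h₄ := reaches_drain (t := t) (d := 6) (a := 1) (inp := []) (out := [1, 2, 3, 4, 5, 6])
    le_rfl (t - 1) (by lia) rfl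
  have h₃ : [1, 2, 3, 4, 5, 6] ++ List.range' (1 + 6) (t - 1) = List.range' 1 (6 + (t - 1)) := by
    rw [← List.range'_append_1]
    rfl
  rw [h₃, confOf_eq_finalConf] at h₄
  have h₅ : ([2, 6, 3, 5, 1] ++ List.range' 7 (t - 1) ++ [4]).length = 6 + (t - 1) := by
    simp
    lia
  rw [h₅]
  exact h₄

theorem not_leftGreedySorts_short (t : ℕ) (ht : 2 < t) :
    ¬ LeftGreedySorts t ([2, 5, 4, 1] ++ List.range' 6 (t - 1) ++ [3]) := by
  intro hs
  change Reaches t _ _ at hs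
  rw [initConf_eq] at hs
  have h₁ : Reaches t
      (confOf t ([2, 5, 4, 1] ++ List.range' 6 (t - 1) ++ [3]) (threeStacks [] [] []) [])
      (confOf t (List.range' 6 (t - 1) ++ [3]) (threeStacks [4] [5] []) [1, 2]) := by
    refine (reaches_enter 0 (by lia) (threeStacks_update_zero [] [] [] [2])
      (fun m _ => ?_) (fun i h _ => ?_)).trans <|
      (reaches_enter 1 (by lia) (threeStacks_update_one [2] [] [] [5])
      (fun m _ => ?_) (fun i h _ => ?_)).trans <|
      (reaches_enter 1 (by lia) (threeStacks_update_one [2] [5] [] [4, 5])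
      (fun m _ => ?_) (fun i h _ => ?_)).trans <|
      (reaches_enter 0 (by lia) (threeStacks_update_zero [2] [4, 5] [] [1, 2])
      (fun m _ => ?_) (fun i h _ => ?_)).trans <|
      (reaches_pop (by lia) rfl rfl (threeStacks_update_zero _ _ _ _)).trans <|
      (reaches_pop (by lia) rfl rfl (threeStacks_update_zero _ _ _ _)).trans <|
      (reaches_slide (x := 4) (k := 0) (j := 1) (f := threeStacks [] [5] []) (by lia) (by lia)
        (threeStacks_update_one ..) (threeStacks_update_zero ..)
        (fun m hm => ?_) (fun i h hi => ?_))
    all_goals first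
      | exact forall_threeStacks (p := fun m => shiftable _ _ m = false) rfl rfl rfl (fun _ => rfl) m
      | (obtain rfl : m = 0 := by lia); rfl
      | rcases i with _ | _ | _ | i <;> first | rfl | lia
  have h₂ : threeStacks [4] [5] [] = ladder [4] 4 1 2 := by
    funext i
    rcases i with _ | _ | _ | i <;> simp [threeStacks, ladder]
  have h₃ : List.range' 6 (t - 1) ++ [3] = List.range' (2 + 4) (t - 2) ++ [t + 4, 3] := by
    rw [show t - 1 = t - 2 + 1 by lia, List.range'_1_concat, List.append_assoc,
      show 6 + (t - 2) = t + 4 by lia]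
    rfl
  rw [h₂, h₃, List.append_assoc, h₃] at h₁
  have h₄ := h₁.trans (reaches_fill (x := 4) (d := 4) (a := 2) (s := []) (by lia) (by simp) le_rfl (t - 2) (by lia))
  rw [show 2 + (t - 2) = t by lia, ← h₃, ← List.append_assoc] at h₄
  have := h₄.eq_of_fixed hs ?_ (greedyStep_finalConf (by lia))
  · simpa [confOf, finalConf] using congrArg Conf.input this
  apply greedyStep_of_not_legal
  intro i hi
  rcases hi.lt_or_eq with h | rfl
  · rw [legal_confOf h, shiftable_ladder (by simp) le_rfl]
  · simp only [legal, confOf, getD_map_range (show i - 1 < i by lia)]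
    simp [ladder, canPush, show i ≠ 0 by lia, show i - 1 ≠ 0 by lia, show 1 ≤ i - 1 by lia,
      show i - 1 < i by lia]

theorem containsPat_long_short (n : ℕ) :
    ContainsPat ([2, 6, 3, 5, 1] ++ List.range' 7 n ++ [4])
      ([2, 5, 4, 1] ++ List.range' 6 n ++ [3]) := by
  apply containsPat_of_map_sublist (φ := fun v => if v ≤ 2 then v else v + 1)
  · intro a b hab
    dsimp only
    split_ifs <;> lia
  · have : (List.range' 6 n).map (fun v => if v ≤ 2 then v else v + 1) = List.range' 7 n := by
      apply List.ext_getElem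
      · simp
      · intro i h₁ h₂
        simp
        lia
    rw [List.map_append, List.map_append, this]
    exact ((show (List.map _ [2, 5, 4, 1]).Sublist [2, 6, 3, 5, 1] by decide).append_right _).append_right _

/-- For `t > 2` the left-greedy algorithm on `t` stacks does not sort a closed class:
`2 6 3 5 1 7 8 ... (t+5) 4` is left-greedy sortable on `t` stacks and contains the
pattern `2 5 4 1 6 7 ... (t+4) 3`, which is not left-greedy sortable on `t` stacks. -/
theorem stmt16 (t : ℕ) (ht : 2 < t) :
    LeftGreedySorts t ([2, 6, 3, 5, 1] ++ List.range' 7 (t - 1) ++ [4]) ∧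
    ContainsPat ([2, 6, 3, 5, 1] ++ List.range' 7 (t - 1) ++ [4])
      ([2, 5, 4, 1] ++ List.range' 6 (t - 1) ++ [3]) ∧
    ¬ LeftGreedySorts t ([2, 5, 4, 1] ++ List.range' 6 (t - 1) ++ [3]) :=
  ⟨leftGreedySorts_long t ht, containsPat_long_short (t - 1), not_leftGreedySorts_short t ht⟩
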